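/- arXiv:2502.00471 — 2 statements merged into one kernel-verified Lean document; each statement's English description precedes it below -/
import Mathlib

section
/- In the one-step ViSE model with a neutral Gaussian proposal generator (μ = 0), the expected capital gain of an individualist equals (σ/√(2π)) · ((P_{t−g−1,ℓ−1} − P_{t−g,ℓ}) + (P_{t−1,ℓ−1} − P_{t,ℓ})) and the expected capital gain of a group member equals (σ/√(2πg)) · (P_{t−g,ℓ} − P_{t,ℓ}), where the quantities P_{k,m} are evaluated at p = q = 1/2. -/
open MeasureTheory ProbabilityTheory
open scoped Classical NNReal

/-- `Pkm p k m` = 1 if `k < -1`; `0` if `k ≥ m`; otherwise `∑_{i=k+1}^m C(m,i) p^i (1-p)^(m-i)`. -/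
noncomputable def Pkm (p : ℝ) (k : ℤ) (m : ℕ) : ℝ :=
  if k < -1 then 1
  else if (m : ℤ) ≤ k then 0
  else ∑ i ∈ Finset.range (m + 1),
    if k < (i : ℤ) then (m.choose i : ℝ) * p ^ i * (1 - p) ^ (m - i) else 0

lemma Pkm_eq (p : ℝ) (k : ℤ) (m : ℕ) : Pkm p k m = ∑ i ∈ Finset.range (m + 1),
    if k < (i : ℤ) then (m.choose i : ℝ) * p ^ i * (1 - p) ^ (m - i) else 0 := by
  unfold Pkm
  split_ifs with h1 h2
  · have : ∀ i ∈ Finset.range (m + 1), (if k < (i : ℤ) then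
        (m.choose i : ℝ) * p ^ i * (1 - p) ^ (m - i) else 0)
        = p ^ i * (1 - p) ^ (m - i) * (m.choose i : ℝ) := by
      intro i _
      rw [if_pos (by omega)]; ring
    rw [Finset.sum_congr rfl this, ← add_pow]
    simp
  · symm
    apply Finset.sum_eq_zero
    intro i hi
    rw [Finset.mem_range] at hi
    rw [if_neg (by omega)]
  · rfl

lemma Pkm_half (k : ℤ) (m : ℕ) : Pkm (1/2) k m = (1/2) ^ m * ∑ i ∈ Finset.range (m + 1),
    (m.choose i : ℝ) * if k < (i : ℤ) then 1 else 0 := by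
  rw [Pkm_eq, Finset.mul_sum]
  refine Finset.sum_congr rfl fun i hi => ?_
  rw [Finset.mem_range] at hi
  split_ifs
  · have : ((1:ℝ)/2)^m = (1/2)^i * (1/2)^(m-i) := by rw [← pow_add]; congr 1; omega
    rw [this]; norm_num; ring
  · simp

lemma Pkm_succ (k : ℤ) (m : ℕ) :
    Pkm (1/2) k (m+1) = 1/2 * Pkm (1/2) k m + 1/2 * Pkm (1/2) (k-1) m := by
  simp only [Pkm_half]
  rw [Finset.sum_range_succ']
  have h : ∀ i ∈ Finset.range (m+1), (((m+1).choose (i+1) : ℕ) : ℝ) *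
      (if k < ((i+1 : ℕ) : ℤ) then (1:ℝ) else 0) =
      (m.choose i : ℝ) * (if k - 1 < (i:ℤ) then 1 else 0) +
      (m.choose (i+1) : ℝ) * (if k < ((i+1 : ℕ) : ℤ) then (1:ℝ) else 0) := by
    intro i _
    have : (k < ((i+1 : ℕ) : ℤ)) ↔ k - 1 < (i:ℤ) := by push_cast; omega
    simp only [this, Nat.choose_succ_succ]
    push_cast; ring
  rw [Finset.sum_congr rfl h, Finset.sum_add_distrib]
  have h2 := Finset.sum_range_succ' (fun i : ℕ => (m.choose i : ℝ) *
      (if k < (i : ℤ) then (1:ℝ) else 0)) (m+1)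
  rw [Finset.sum_range_succ] at h2
  simp only [Nat.choose_succ_self, Nat.cast_zero, zero_mul, add_zero, Nat.choose_zero_right] at h2 ⊢
  rw [h2]; ring

lemma integrable_id_gauss (v : ℝ≥0) : Integrable (fun x : ℝ => x) (gaussianReal 0 v) :=
  (memLp_id_gaussianReal' (μ := 0) (v := v) 1 (by simp)).integrable le_rfl

lemma meas_pos : Measurable (fun x : ℝ => if 0 < x then x else 0) :=
  Measurable.ite measurableSet_Ioi measurable_id measurable_const
lemma meas_neg : Measurable (fun x : ℝ => if 0 < x then 0 else x) :=
  Measurable.ite measurableSet_Ioi measurable_const measurable_id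
lemma meas_U : Measurable (fun x : ℝ => if 0 < x then (1:ℝ) else 0) :=
  Measurable.ite measurableSet_Ioi measurable_const measurable_const
lemma meas_V : Measurable (fun x : ℝ => if 0 < x then (0:ℝ) else 1) :=
  Measurable.ite measurableSet_Ioi measurable_const measurable_const

lemma integrable_pos (v : ℝ≥0) :
    Integrable (fun x : ℝ => if 0 < x then x else 0) (gaussianReal 0 v) := by
  refine (integrable_id_gauss v).mono meas_pos.aestronglyMeasurable (.of_forall fun x => ?_)
  split_ifs <;> simp

lemma integrable_neg' (v : ℝ≥0) :
    Integrable (fun x : ℝ => if 0 < x then 0 else x) (gaussianReal 0 v) := by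
  refine (integrable_id_gauss v).mono meas_neg.aestronglyMeasurable (.of_forall fun x => ?_)
  split_ifs <;> simp

lemma integral_pos_gauss (σ : ℝ) (hσ : 0 < σ) (v : ℝ≥0) (hv : (v:ℝ) = σ^2) :
    ∫ x, (if 0 < x then x else 0) ∂gaussianReal 0 v = σ / Real.sqrt (2 * Real.pi) := by
  have hv0 : v ≠ 0 := by
    intro h; rw [h] at hv; simp at hv; exact (pow_pos hσ 2).ne hv
  rw [integral_gaussianReal_eq_integral_smul hv0]
  have h1 : ∀ x : ℝ, gaussianPDFReal 0 v x • (if 0 < x then x else 0) =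
      (Set.Ioi (0:ℝ)).indicator (fun x => (Real.sqrt (2 * Real.pi * v))⁻¹ *
        (x ^ (1:ℝ) * Real.exp (-(2*(v:ℝ))⁻¹ * x ^ (2:ℝ)))) x := by
    intro x
    by_cases hx : 0 < x
    · rw [Set.indicator_of_mem (by exact hx), if_pos hx, gaussianPDFReal_def]
      simp only [sub_zero, smul_eq_mul, Real.rpow_one, Real.rpow_two]
      rw [show -x^2 / (2*(v:ℝ)) = -(2*(v:ℝ))⁻¹ * x^2 by rw [div_eq_mul_inv]; ring]
      ring
    · rw [Set.indicator_of_notMem (by exact hx), if_neg hx]; simp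
  simp_rw [h1]
  rw [integral_indicator measurableSet_Ioi, integral_const_mul,
    integral_rpow_mul_exp_neg_mul_rpow (by norm_num) (by norm_num) (by rw [hv]; positivity)]
  rw [hv]
  rw [Real.sqrt_mul (by positivity), Real.sqrt_sq hσ.le]
  rw [show -((1:ℝ)+1)/2 = -1 by norm_num, show ((1:ℝ)+1)/2 = 1 by norm_num, Real.Gamma_one,
    Real.rpow_neg_one]
  have : Real.sqrt (2*Real.pi) ≠ 0 := by positivity
  field_simp

lemma integral_neg_gauss (σ : ℝ) (hσ : 0 < σ) (v : ℝ≥0) (hv : (v:ℝ) = σ^2) :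
    ∫ x, (if 0 < x then 0 else x) ∂gaussianReal 0 v = -(σ / Real.sqrt (2 * Real.pi)) := by
  have h := integral_id_gaussianReal (μ := 0) (v := v)
  have h2 : ∀ x : ℝ, x = (if 0 < x then x else 0) + (if 0 < x then 0 else x) := by
    intro x; split_ifs <;> simp
  rw [integral_congr_ae (.of_forall h2), integral_add (integrable_pos v) (integrable_neg' v),
    integral_pos_gauss σ hσ v hv] at h
  linarith

lemma integrable_U (μ : Measure ℝ) [IsFiniteMeasure μ] :
    Integrable (fun x : ℝ => if 0 < x then (1:ℝ) else 0) μ := by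
  refine Integrable.of_bound meas_U.aestronglyMeasurable 1 (.of_forall fun x => ?_)
  split_ifs <;> simp
lemma integrable_V (μ : Measure ℝ) [IsFiniteMeasure μ] :
    Integrable (fun x : ℝ => if 0 < x then (0:ℝ) else 1) μ := by
  refine Integrable.of_bound meas_V.aestronglyMeasurable 1 (.of_forall fun x => ?_)
  split_ifs <;> simp

lemma integral_UV (v : ℝ≥0) (hv : v ≠ 0) :
    ∫ x, (if 0 < x then (1:ℝ) else 0) ∂gaussianReal 0 v = 1/2 ∧
    ∫ x, (if 0 < x then (0:ℝ) else 1) ∂gaussianReal 0 v = 1/2 := by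
  have h1 : ∫ x, (if 0 < x then (1:ℝ) else 0) ∂gaussianReal 0 v =
      ∫ x, (if 0 < x then (0:ℝ) else 1) ∂gaussianReal 0 v := by
    have hm := gaussianReal_map_neg (μ := 0) (v := v)
    rw [neg_zero] at hm
    conv_lhs => rw [← hm]
    rw [integral_map (by fun_prop) meas_U.aestronglyMeasurable]
    refine integral_congr_ae ?_
    have : NullSingletonClass (gaussianReal 0 v) := nullSingletonClass_gaussianReal hv
    have h0 : ∀ᵐ x ∂gaussianReal 0 v, x ≠ 0 := by
      rw [ae_iff]; simp
    filter_upwards [h0] with x hx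
    rcases lt_or_gt_of_ne hx with h | h
    · rw [if_pos (by linarith), if_neg (by linarith)]
    · rw [if_neg (by linarith), if_pos h]
  have h2 : ∫ x, (if 0 < x then (1:ℝ) else 0) ∂gaussianReal 0 v +
      ∫ x, (if 0 < x then (0:ℝ) else 1) ∂gaussianReal 0 v = 1 := by
    rw [← integral_add (integrable_U _) (integrable_V _)]
    have : ∀ x : ℝ, (if 0 < x then (1:ℝ) else 0) + (if 0 < x then (0:ℝ) else 1) = 1 := by
      intro x; split_ifs <;> simp
    simp [this]
  constructor <;> linarith

section
variable {n : ℕ}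

lemma indep_of_dep (μ : Measure ℝ) [IsProbabilityMeasure μ] (S T : Finset (Fin n))
    (hST : Disjoint S T) (φ ψ : (Fin n → ℝ) → ℝ) (hφ : Measurable φ) (hψ : Measurable ψ)
    (dφ : DependsOn φ (S : Set (Fin n))) (dψ : DependsOn ψ (T : Set (Fin n))) :
    IndepFun φ ψ (Measure.pi fun _ : Fin n => μ) := by
  have h0 : iIndepFun (fun (i : Fin n) (ω : Fin n → ℝ) => ω i) (Measure.pi fun _ : Fin n => μ) :=
    iIndepFun_pi (μ := fun _ : Fin n => μ) (X := fun _ x => x) (fun _ => aemeasurable_id)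
  have h := h0.indepFun_finset S T hST (fun i => measurable_pi_apply i)
  have ext_meas : ∀ R : Finset (Fin n), Measurable
      (fun (x : R → ℝ) (i : Fin n) => if h : i ∈ R then x ⟨i, h⟩ else 0) := by
    intro R
    refine measurable_pi_lambda _ fun i => ?_
    by_cases h : i ∈ R
    · simp only [h, dite_true]; exact measurable_pi_apply _
    · simp only [h, dite_false]; exact measurable_const
  have h' := h.comp (hφ.comp (ext_meas S)) (hψ.comp (ext_meas T))
  convert h' using 1
  · funext ω
    apply dφ
    intro i hi
    simp [Finset.mem_coe.1 hi]
  · funext ω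
    apply dψ
    intro i hi
    simp [Finset.mem_coe.1 hi]

lemma key (μ : Measure ℝ) [IsProbabilityMeasure μ] (S T : Finset (Fin n))
    (hST : Disjoint S T) (φ ψ : (Fin n → ℝ) → ℝ) (hφ : Measurable φ) (hψ : Measurable ψ)
    (dφ : DependsOn φ (S : Set (Fin n))) (dψ : DependsOn ψ (T : Set (Fin n)))
    (iφ : Integrable φ (Measure.pi fun _ : Fin n => μ))
    (iψ : Integrable ψ (Measure.pi fun _ : Fin n => μ)) :
    Integrable (fun ω => φ ω * ψ ω) (Measure.pi fun _ : Fin n => μ) ∧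
    ∫ ω, φ ω * ψ ω ∂(Measure.pi fun _ : Fin n => μ) =
      (∫ ω, φ ω ∂(Measure.pi fun _ : Fin n => μ)) * ∫ ω, ψ ω ∂(Measure.pi fun _ : Fin n => μ) := by
  have h := indep_of_dep μ S T hST φ ψ hφ hψ dφ dψ
  exact ⟨h.integrable_mul iφ iψ,
    h.integral_fun_mul_eq_mul_integral iφ.aestronglyMeasurable iψ.aestronglyMeasurable⟩

/-- number of positive coordinates in `S` -/
noncomputable def cnt (S : Finset (Fin n)) (ω : Fin n → ℝ) : ℤ :=
  ∑ i ∈ S, if 0 < ω i then 1 else 0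

/-- indicator that more than `k` coordinates in `S` are positive -/
noncomputable def Ik (k : ℤ) (S : Finset (Fin n)) (ω : Fin n → ℝ) : ℝ :=
  if k < cnt S ω then 1 else 0

lemma cnt_meas (S : Finset (Fin n)) : Measurable (cnt S) := by
  unfold cnt
  refine Finset.measurable_sum _ fun i _ => ?_
  exact Measurable.ite (measurableSet_lt measurable_const (measurable_pi_apply i))
    measurable_const measurable_const

lemma Ik_meas (k : ℤ) (S : Finset (Fin n)) : Measurable (Ik k S) := by
  unfold Ik
  exact Measurable.ite (measurableSet_lt measurable_const (cnt_meas S))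
    measurable_const measurable_const

lemma Ik_dep (k : ℤ) (S : Finset (Fin n)) : DependsOn (Ik k S) (S : Set (Fin n)) := by
  intro x y h
  unfold Ik cnt
  rw [Finset.sum_congr rfl fun i hi => by rw [h i (Finset.mem_coe.2 hi)]]

lemma Ik_int (μ : Measure ℝ) [IsProbabilityMeasure μ] (k : ℤ) (S : Finset (Fin n)) :
    Integrable (Ik k S) (Measure.pi fun _ : Fin n => μ) := by
  refine Integrable.of_bound (Ik_meas k S).aestronglyMeasurable 1 (.of_forall fun x => ?_)
  unfold Ik
  split_ifs <;> simp

lemma coord_dep (f : ℝ → ℝ) (a : Fin n) :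
    DependsOn (fun ω : Fin n → ℝ => f (ω a)) (({a} : Finset (Fin n)) : Set (Fin n)) := by
  intro x y h
  have := h a (by simp)
  simp [this]

lemma coord_map (μ : Measure ℝ) [IsProbabilityMeasure μ] (a : Fin n) :
    (Measure.pi fun _ : Fin n => μ).map (fun ω => ω a) = μ :=
  (measurePreserving_eval (fun _ : Fin n => μ) a).map_eq

lemma law_int {Ω : Type*} [MeasurableSpace Ω] {P : Measure Ω} {X : Ω → ℝ} (hX : Measurable X)
    {μ : Measure ℝ} (h : P.map X = μ) {f : ℝ → ℝ} (hf : Measurable f) (hi : Integrable f μ) :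
    Integrable (fun ω => f (X ω)) P ∧ ∫ ω, f (X ω) ∂P = ∫ x, f x ∂μ := by
  subst h
  constructor
  · exact (integrable_map_measure hf.aestronglyMeasurable hX.aemeasurable).1 hi
  · rw [integral_map hX.aemeasurable hf.aestronglyMeasurable]

lemma Ik_insert (k : ℤ) (S : Finset (Fin n)) (a : Fin n) (ha : a ∉ S) (ω : Fin n → ℝ) :
    Ik k (insert a S) ω = (if 0 < ω a then 1 else 0) * Ik (k-1) S ω +
      (if 0 < ω a then 0 else 1) * Ik k S ω := by
  unfold Ik
  have : cnt (insert a S) ω = (if 0 < ω a then 1 else 0) + cnt S ω := by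
    unfold cnt; rw [Finset.sum_insert ha]
  rw [this]
  by_cases h : 0 < ω a
  · simp only [h, if_true, one_mul, zero_mul, add_zero]
    congr 1
    apply propext; omega
  · simp [h]

lemma Ik_integral (v : ℝ≥0) (hv : v ≠ 0) (S : Finset (Fin n)) : ∀ k : ℤ,
    ∫ ω, Ik k S ω ∂(Measure.pi fun _ : Fin n => gaussianReal 0 v) = Pkm (1/2) k S.card := by
  induction S using Finset.induction_on with
  | empty =>
    intro k
    rw [Pkm_half]; simp [Ik, cnt]
  | insert a S ha ih =>
    intro k
    have hd : Disjoint {a} S := by simpa using ha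
    obtain ⟨iU, eU⟩ := law_int (measurable_pi_apply a) (coord_map (gaussianReal 0 v) a)
      meas_U (integrable_U _)
    obtain ⟨iV, eV⟩ := law_int (measurable_pi_apply a) (coord_map (gaussianReal 0 v) a)
      meas_V (integrable_V _)
    obtain ⟨i1, e1⟩ := key (gaussianReal 0 v) {a} S hd (fun ω => if 0 < ω a then (1:ℝ) else 0) _
      (meas_U.comp (measurable_pi_apply a)) (Ik_meas (k-1) S) (coord_dep (fun x => if 0 < x then (1:ℝ) else 0) a) (Ik_dep _ S) iU
      (Ik_int _ _ _)
    obtain ⟨i2, e2⟩ := key (gaussianReal 0 v) {a} S hd (fun ω => if 0 < ω a then (0:ℝ) else 1) _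
      (meas_V.comp (measurable_pi_apply a)) (Ik_meas k S) (coord_dep (fun x => if 0 < x then (0:ℝ) else 1) a) (Ik_dep _ S) iV
      (Ik_int _ _ _)
    simp_rw [Ik_insert k S a ha]
    rw [integral_add i1 i2, e1, e2, eU, eV, (integral_UV v hv).1, (integral_UV v hv).2, ih, ih,
      Finset.card_insert_of_notMem ha, Pkm_succ]
    ring

lemma sum_law (v : ℝ≥0) (S : Finset (Fin n)) :
    (Measure.pi fun _ : Fin n => gaussianReal 0 v).map (fun ω => ∑ j ∈ S, ω j) =
      gaussianReal 0 (S.card * v) := by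
  induction S using Finset.induction_on with
  | empty =>
    simp [gaussianReal_zero_var]
  | insert a S ha ih =>
    have hd : Disjoint {a} S := by simpa using ha
    have hi := indep_of_dep (gaussianReal 0 v) {a} S hd (fun ω => ω a) (fun ω => ∑ j ∈ S, ω j)
      (by fun_prop) (by fun_prop) (coord_dep id a)
      (fun x y h => Finset.sum_congr rfl fun i hi => h i (Finset.mem_coe.2 hi))
    have := gaussianReal_add_gaussianReal_of_indepFun hi (coord_map _ a) ih
    simp_rw [Finset.sum_insert ha]
    rw [Finset.card_insert_of_notMem ha]
    have h2 : ((S.card + 1 : ℕ) : ℝ≥0) * v = v + S.card * v := by push_cast; ring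
    rw [h2]
    rw [add_zero] at this
    exact this

end

section
variable {n : ℕ}

lemma card_split (G : Finset (Fin n)) (ω : Fin n → ℝ) :
    ((Finset.univ.filter fun i : Fin n =>
        if i ∈ G then 0 < ∑ j ∈ G, ω j else 0 < ω i).card : ℤ) =
      (if 0 < ∑ j ∈ G, ω j then (G.card : ℤ) else 0) + cnt Gᶜ ω := by
  rw [Finset.card_filter]
  push_cast
  rw [← Finset.sum_add_sum_compl G]
  congr 1
  · rw [Finset.sum_congr rfl (g := fun _ => if 0 < ∑ j ∈ G, ω j then (1:ℤ) else 0)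
      (fun i hi => by simp [hi])]
    split_ifs <;> simp
  · unfold cnt
    refine Finset.sum_congr rfl fun i hi => ?_
    simp [Finset.mem_compl.1 hi]

/-- indicator of acceptance -/
lemma ind_split (G : Finset (Fin n)) (t : ℤ) (f : (Fin n → ℝ) → ℝ) (ω : Fin n → ℝ) :
    ({ω : Fin n → ℝ |
      t < ((Finset.univ.filter fun i : Fin n =>
        if i ∈ G then 0 < ∑ j ∈ G, ω j else 0 < ω i).card : ℤ)}).indicator f ω =
      f ω * ((if 0 < ∑ j ∈ G, ω j then 1 else 0) * Ik (t - G.card) Gᶜ ω +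
        (if 0 < ∑ j ∈ G, ω j then 0 else 1) * Ik t Gᶜ ω) := by
  rw [Set.indicator_apply]
  simp only [Set.mem_ofPred_eq, card_split]
  unfold Ik
  by_cases h : 0 < ∑ j ∈ G, ω j
  · have h2 : t < (G.card : ℤ) + cnt Gᶜ ω ↔ t - G.card < cnt Gᶜ ω := by omega
    simp [h, h2]
  · simp [h]

lemma acc_meas (G : Finset (Fin n)) (t : ℤ) : MeasurableSet {ω : Fin n → ℝ |
      t < ((Finset.univ.filter fun i : Fin n =>
        if i ∈ G then 0 < ∑ j ∈ G, ω j else 0 < ω i).card : ℤ)} := by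
  simp only [card_split]
  refine measurableSet_lt measurable_const (Measurable.add ?_ (cnt_meas _))
  exact Measurable.ite (measurableSet_lt measurable_const (by fun_prop))
    measurable_const measurable_const

lemma sum_dep (f : ℝ → ℝ) (G : Finset (Fin n)) :
    DependsOn (fun ω : Fin n → ℝ => f (∑ j ∈ G, ω j)) (G : Set (Fin n)) := by
  intro x y h
  dsimp only
  rw [Finset.sum_congr rfl fun i hi => h i (Finset.mem_coe.2 hi)]

/-- product of function of group sum and count on a disjoint set -/
lemma sum_key (v : ℝ≥0) (hv : v ≠ 0) (G T : Finset (Fin n)) (hd : Disjoint G T) (k : ℤ)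
    (f : ℝ → ℝ) (hf : Measurable f) (hi : Integrable f (gaussianReal 0 (G.card * v))) :
    Integrable (fun ω : Fin n → ℝ => f (∑ j ∈ G, ω j) * Ik k T ω)
      (Measure.pi fun _ : Fin n => gaussianReal 0 v) ∧
    ∫ ω, f (∑ j ∈ G, ω j) * Ik k T ω ∂(Measure.pi fun _ : Fin n => gaussianReal 0 v) =
      (∫ x, f x ∂gaussianReal 0 (G.card * v)) * Pkm (1/2) k T.card := by
  have hm : Measurable (fun ω : Fin n → ℝ => ∑ j ∈ G, ω j) := by fun_prop
  obtain ⟨i1, e1⟩ := law_int hm (sum_law v G) hf hi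
  obtain ⟨i2, e2⟩ := key (gaussianReal 0 v) G T hd (fun ω => f (∑ j ∈ G, ω j)) (Ik k T)
    (hf.comp hm) (Ik_meas k T) (sum_dep f G) (Ik_dep k T) i1 (Ik_int _ _ _)
  exact ⟨i2, by rw [e2, e1, Ik_integral v hv]⟩

lemma swap_int (v : ℝ≥0) (G : Finset (Fin n)) (t : ℤ) (i j : Fin n) (hi : i ∈ G) (hj : j ∈ G) :
    ∫ ω in {ω : Fin n → ℝ |
      t < ((Finset.univ.filter fun i : Fin n =>
        if i ∈ G then 0 < ∑ j ∈ G, ω j else 0 < ω i).card : ℤ)}, ω i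
        ∂(Measure.pi fun _ : Fin n => gaussianReal 0 v) =
    ∫ ω in {ω : Fin n → ℝ |
      t < ((Finset.univ.filter fun i : Fin n =>
        if i ∈ G then 0 < ∑ j ∈ G, ω j else 0 < ω i).card : ℤ)}, ω j
        ∂(Measure.pi fun _ : Fin n => gaussianReal 0 v) := by
  rw [← integral_indicator (acc_meas G t), ← integral_indicator (acc_meas G t)]
  have hp := measurePreserving_piCongrLeft (fun _ : Fin n => gaussianReal 0 v) (Equiv.swap i j)
  rw [← hp.integral_comp']
  refine integral_congr_ae (.of_forall fun ω => ?_)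
  have he : ∀ k, (MeasurableEquiv.piCongrLeft (fun _ : Fin n => ℝ) (Equiv.swap i j)) ω k
      = ω (Equiv.swap i j k) := by
    intro k
    have := Equiv.piCongrLeft_apply_apply (fun _ : Fin n => ℝ) (Equiv.swap i j) ω
      (Equiv.swap i j k)
    rw [Equiv.swap_apply_self] at this
    exact this
  have hmem : ∀ k, Equiv.swap i j k ∈ G ↔ k ∈ G := by
    intro k
    rcases eq_or_ne k i with rfl | h1
    · simp [hi, hj]
    rcases eq_or_ne k j with rfl | h2
    · simp [hi, hj]
    rw [Equiv.swap_apply_of_ne_of_ne h1 h2]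
  have hs : ∑ k ∈ G, ω (Equiv.swap i j k) = ∑ k ∈ G, ω k :=
    Finset.sum_equiv (Equiv.swap i j) (fun k => (hmem k).symm) (fun _ _ => rfl)
  have hc : cnt Gᶜ ((MeasurableEquiv.piCongrLeft (fun _ : Fin n => ℝ) (Equiv.swap i j)) ω)
      = cnt Gᶜ ω := by
    unfold cnt
    simp only [he]
    exact Finset.sum_equiv (Equiv.swap i j) (fun k => by simp [hmem]) (fun _ _ => rfl)
  dsimp only
  rw [ind_split, ind_split]
  unfold Ik
  rw [hc]
  simp only [he, hs, Equiv.swap_apply_left]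

lemma group_ECG (v : ℝ≥0) (σ : ℝ) (hσ : 0 < σ) (hv : (v:ℝ) = σ^2) (G : Finset (Fin n)) (t : ℤ)
    (i : Fin n) (hi : i ∈ G) :
    ∫ ω in {ω : Fin n → ℝ |
      t < ((Finset.univ.filter fun i : Fin n =>
        if i ∈ G then 0 < ∑ j ∈ G, ω j else 0 < ω i).card : ℤ)}, ω i
        ∂(Measure.pi fun _ : Fin n => gaussianReal 0 v) =
    σ / Real.sqrt (2 * Real.pi * G.card) *
      (Pkm (1/2) (t - G.card) Gᶜ.card - Pkm (1/2) t Gᶜ.card) := by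
  have hv0 : v ≠ 0 := by
    intro h; rw [h] at hv; simp at hv; exact (pow_pos hσ 2).ne hv
  have hg : 0 < (G.card : ℝ) := by exact_mod_cast Finset.card_pos.2 ⟨i, hi⟩
  have hsum : ∫ ω in {ω : Fin n → ℝ |
      t < ((Finset.univ.filter fun i : Fin n =>
        if i ∈ G then 0 < ∑ j ∈ G, ω j else 0 < ω i).card : ℤ)}, ∑ j ∈ G, ω j
        ∂(Measure.pi fun _ : Fin n => gaussianReal 0 v) =
      G.card * ∫ ω in {ω : Fin n → ℝ |
      t < ((Finset.univ.filter fun i : Fin n =>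
        if i ∈ G then 0 < ∑ j ∈ G, ω j else 0 < ω i).card : ℤ)}, ω i
        ∂(Measure.pi fun _ : Fin n => gaussianReal 0 v) := by
    rw [integral_finsetSum, Finset.sum_congr rfl fun j hj => swap_int v G t j i hj hi]
    · simp
    · intro j _
      exact (law_int (measurable_pi_apply j) (coord_map (gaussianReal 0 v) j) measurable_id
        (integrable_id_gauss v)).1.integrableOn
  rw [← integral_indicator (acc_meas G t)] at hsum
  have h1 : ∀ ω : Fin n → ℝ, ({ω : Fin n → ℝ |
      t < ((Finset.univ.filter fun i : Fin n =>
        if i ∈ G then 0 < ∑ j ∈ G, ω j else 0 < ω i).card : ℤ)}).indicator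
        (fun ω => ∑ j ∈ G, ω j) ω =
      (fun x : ℝ => if 0 < x then x else 0) (∑ j ∈ G, ω j) * Ik (t - G.card) Gᶜ ω +
      (fun x : ℝ => if 0 < x then 0 else x) (∑ j ∈ G, ω j) * Ik t Gᶜ ω := by
    intro ω
    rw [ind_split]
    dsimp only
    split_ifs <;> ring
  obtain ⟨i1, e1⟩ := sum_key v hv0 G Gᶜ disjoint_compl_right (t - G.card) _ meas_pos
    (integrable_pos _)
  obtain ⟨i2, e2⟩ := sum_key v hv0 G Gᶜ disjoint_compl_right t _ meas_neg
    (integrable_neg' _)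
  have hs' : 0 < σ * Real.sqrt G.card := by positivity
  have hv' : (((G.card : ℝ≥0) * v : ℝ≥0) : ℝ) = (σ * Real.sqrt G.card)^2 := by
    rw [mul_pow, Real.sq_sqrt hg.le]; push_cast; rw [hv]; ring
  rw [integral_congr_ae (.of_forall h1), integral_add i1 i2, e1, e2,
    integral_pos_gauss _ hs' _ hv', integral_neg_gauss _ hs' _ hv'] at hsum
  have h3 : Real.sqrt (2 * Real.pi * G.card) = Real.sqrt (2 * Real.pi) * Real.sqrt G.card :=
    Real.sqrt_mul (by positivity) _
  have h4 : Real.sqrt G.card * Real.sqrt G.card = (G.card : ℝ) := Real.mul_self_sqrt hg.le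
  have h5 : 0 < Real.sqrt (G.card : ℝ) := by positivity
  have h6 : 0 < Real.sqrt (2 * Real.pi) := by positivity
  apply mul_left_cancel₀ hg.ne'
  rw [← hsum, h3]
  have h7 : (G.card : ℝ) * (σ / (Real.sqrt (2 * Real.pi) * Real.sqrt G.card)) =
      σ * Real.sqrt G.card / Real.sqrt (2 * Real.pi) := by
    rw [mul_div_assoc', div_eq_div_iff (by positivity) (by positivity)]
    linear_combination (-σ * Real.sqrt (2 * Real.pi)) * h4
  rw [← mul_assoc, h7]
  ring

lemma indiv_ECG (v : ℝ≥0) (σ : ℝ) (hσ : 0 < σ) (hv : (v:ℝ) = σ^2) (G : Finset (Fin n))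
    (hG : G.Nonempty) (t : ℤ) (i : Fin n) (hi : i ∉ G) (m : ℕ) (hm : Gᶜ.card = m + 1) :
    ∫ ω in {ω : Fin n → ℝ |
      t < ((Finset.univ.filter fun i : Fin n =>
        if i ∈ G then 0 < ∑ j ∈ G, ω j else 0 < ω i).card : ℤ)}, ω i
        ∂(Measure.pi fun _ : Fin n => gaussianReal 0 v) =
    σ / Real.sqrt (2 * Real.pi) *
      ((Pkm (1/2) (t - G.card - 1) m - Pkm (1/2) (t - G.card) (m+1)) +
       (Pkm (1/2) (t - 1) m - Pkm (1/2) t (m+1))) := by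
  have hv0 : v ≠ 0 := by
    intro h; rw [h] at hv; simp at hv; exact (pow_pos hσ 2).ne hv
  have hgv : (G.card : ℝ≥0) * v ≠ 0 :=
    mul_ne_zero (by exact_mod_cast (Finset.card_pos.2 hG).ne') hv0
  rw [← integral_indicator (acc_meas G t)]
  set T := Gᶜ.erase i with hT
  have hiT : i ∉ T := Finset.notMem_erase i _
  have hins : Gᶜ = insert i T := (Finset.insert_erase (by simpa using hi)).symm
  have hTc : T.card = m := by
    rw [hT, Finset.card_erase_of_mem (by simpa using hi), hm]; rfl
  have hGT : Disjoint G T := by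
    refine Finset.disjoint_left.2 fun x hx hx' => ?_
    exact Finset.mem_compl.1 (Finset.mem_of_mem_erase hx') hx
  let B : ℤ → ℤ → (Fin n → ℝ) → ℝ := fun k l ω =>
    (fun x : ℝ => if 0 < x then (1:ℝ) else 0) (∑ j ∈ G, ω j) * Ik k T ω +
    (fun x : ℝ => if 0 < x then (0:ℝ) else 1) (∑ j ∈ G, ω j) * Ik l T ω
  have hsm : Measurable (fun ω : Fin n → ℝ => ∑ j ∈ G, ω j) := by fun_prop
  have Bm : ∀ k l, Measurable (B k l) := fun k l =>
    ((meas_U.comp hsm).mul (Ik_meas k T)).add ((meas_V.comp hsm).mul (Ik_meas l T))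
  have Bd : ∀ k l, DependsOn (B k l) ((G ∪ T : Finset (Fin n)) : Set (Fin n)) := by
    intro k l x y h
    have h1 := sum_dep id G (x := x) (y := y)
      (fun i hi => h i (Finset.mem_coe.2 (Finset.mem_union_left _ (Finset.mem_coe.1 hi))))
    have h2 := Ik_dep k T (x := x) (y := y)
      (fun i hi => h i (Finset.mem_coe.2 (Finset.mem_union_right _ (Finset.mem_coe.1 hi))))
    have h3 := Ik_dep l T (x := x) (y := y)
      (fun i hi => h i (Finset.mem_coe.2 (Finset.mem_union_right _ (Finset.mem_coe.1 hi))))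
    simp only [id] at h1
    simp only [B, h1, h2, h3]
  have Bi : ∀ k l, Integrable (B k l) (Measure.pi fun _ : Fin n => gaussianReal 0 v) ∧
      ∫ ω, B k l ω ∂(Measure.pi fun _ : Fin n => gaussianReal 0 v) =
        1/2 * Pkm (1/2) k m + 1/2 * Pkm (1/2) l m := by
    intro k l
    obtain ⟨i1, e1⟩ := sum_key v hv0 G T hGT k _ meas_U (integrable_U _)
    obtain ⟨i2, e2⟩ := sum_key v hv0 G T hGT l _ meas_V (integrable_V _)
    refine ⟨i1.add i2, ?_⟩
    simp only [B]
    rw [integral_add i1 i2, e1, e2, (integral_UV _ hgv).1, (integral_UV _ hgv).2, hTc]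
  have hd : Disjoint {i} (G ∪ T) := by simp [hi, hiT]
  obtain ⟨ip, ep⟩ := law_int (measurable_pi_apply i) (coord_map (gaussianReal 0 v) i)
      meas_pos (integrable_pos _)
  obtain ⟨iq, eq⟩ := law_int (measurable_pi_apply i) (coord_map (gaussianReal 0 v) i)
      meas_neg (integrable_neg' _)
  obtain ⟨i1, e1⟩ := key (gaussianReal 0 v) {i} (G ∪ T) hd
    (fun ω => if 0 < ω i then ω i else 0) (B (t - G.card - 1) (t - 1))
    (meas_pos.comp (measurable_pi_apply i)) (Bm _ _)
    (coord_dep (fun x => if 0 < x then x else 0) i) (Bd _ _) ip (Bi _ _).1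
  obtain ⟨i2, e2⟩ := key (gaussianReal 0 v) {i} (G ∪ T) hd
    (fun ω => if 0 < ω i then 0 else ω i) (B (t - G.card) t)
    (meas_neg.comp (measurable_pi_apply i)) (Bm _ _)
    (coord_dep (fun x => if 0 < x then 0 else x) i) (Bd _ _) iq (Bi _ _).1
  have h1 : ∀ ω : Fin n → ℝ, ({ω : Fin n → ℝ |
      t < ((Finset.univ.filter fun i : Fin n =>
        if i ∈ G then 0 < ∑ j ∈ G, ω j else 0 < ω i).card : ℤ)}).indicator
        (fun ω => ω i) ω =
      (if 0 < ω i then ω i else 0) * B (t - G.card - 1) (t - 1) ω +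
      (if 0 < ω i then 0 else ω i) * B (t - G.card) t ω := by
    intro ω
    rw [ind_split, hins, Ik_insert _ _ _ hiT, Ik_insert _ _ _ hiT]
    simp only [B]
    split_ifs <;> ring
  rw [integral_congr_ae (.of_forall h1), integral_add i1 i2, e1, e2, ep, eq, (Bi _ _).2, (Bi _ _).2,
    integral_pos_gauss σ hσ v hv, integral_neg_gauss σ hσ v hv, Pkm_succ, Pkm_succ]
  ring

end

/-- In the one-step ViSE model with a neutral Gaussian proposal generator
(`μ = 0`), the expected capital gain of an individualist equals
`(σ/√(2π)) ((P_{t−g−1,ℓ−1} − P_{t−g,ℓ}) + (P_{t−1,ℓ−1} − P_{t,ℓ}))` and the expected capital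
gain of a group member equals `(σ/√(2πg)) (P_{t−g,ℓ} − P_{t,ℓ})`, where the `P_{k,m}` are
evaluated at `p = 1/2`. -/
theorem neutral_ECG
    (n : ℕ) (G : Finset (Fin n)) (g ℓ : ℕ)
    (hgcard : G.card = g) (hg1 : 1 ≤ g) (hℓ : ℓ = n - g)
    (σ : ℝ) (hσ : 0 < σ) (t : ℤ)
    -- the proposal is a vector of i.i.d. N(0, σ²) components (neutral environment, μ = 0)
    (ν : Measure (Fin n → ℝ))
    (hν : ν = Measure.pi fun _ : Fin n => gaussianReal 0 (⟨σ ^ 2, sq_nonneg σ⟩ : ℝ≥0))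
    -- the set of proposals that are accepted: strictly more than `t` votes in favor,
    -- where individualist `i` votes iff `ω i > 0` and group members vote iff `∑_{j∈G} ω j > 0`
    (A : Set (Fin n → ℝ))
    (hA : A = {ω : Fin n → ℝ |
      t < ((Finset.univ.filter fun i : Fin n =>
        if i ∈ G then 0 < ∑ j ∈ G, ω j else 0 < ω i).card : ℤ)}) :
    -- the individualist's ECG (assuming ℓ ≥ 1)
    (1 ≤ ℓ → ∀ i : Fin n, i ∉ G →
      ∫ ω in A, ω i ∂ν =
        σ / Real.sqrt (2 * Real.pi) *
          ((Pkm (1/2) (t - g - 1) (ℓ - 1) - Pkm (1/2) (t - g) ℓ)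
            + (Pkm (1/2) (t - 1) (ℓ - 1) - Pkm (1/2) t ℓ)))
    ∧
    -- the group member's ECG
    (∀ i : Fin n, i ∈ G →
      ∫ ω in A, ω i ∂ν =
        σ / Real.sqrt (2 * Real.pi * g) * (Pkm (1/2) (t - g) ℓ - Pkm (1/2) t ℓ)) := by
  subst hA hν hgcard
  have hcc : Gᶜ.card = ℓ := by rw [Finset.card_compl, Fintype.card_fin, hℓ]
  have hv : (((⟨σ ^ 2, sq_nonneg σ⟩ : ℝ≥0)) : ℝ) = σ ^ 2 := rfl
  refine ⟨fun hl i hi => ?_, fun i hi => ?_⟩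
  · obtain ⟨m, rfl⟩ : ∃ m, ℓ = m + 1 := ⟨ℓ - 1, by omega⟩
    exact indiv_ECG _ σ hσ hv G (Finset.card_pos.1 hg1) t i hi m hcc
  · have := group_ECG _ σ hσ hv G t i hi
    rw [hcc] at this
    exact this
end

section
/- In the one-step ViSE model with a Gaussian proposal generator, if the group alone can both pass and block any proposal, i.e., ℓ ≤ t < g, then all decisions are made by the group: the expected capital gain of an individualist equals μ Φ(√g μ/σ) and the expected capital gain of a group member equals μ Φ(√g μ/σ) + (σ/√g) φ(√g μ/σ). In particular, in a neutral environment (μ = 0) the individualist's expected capital gain is 0 and the group member's expected capital gain is σ/√(2πg). -/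
open MeasureTheory ProbabilityTheory
open scoped Classical NNReal

/-- Standard normal probability density function. -/
noncomputable def stdPDF (x : ℝ) : ℝ := (Real.sqrt (2 * Real.pi))⁻¹ * Real.exp (-(x ^ 2) / 2)

/-- Standard normal cumulative distribution function. -/
noncomputable def stdCDF (x : ℝ) : ℝ := ∫ u in Set.Iic x, stdPDF u

lemma stdPDF_eq_gaussianPDFReal (x : ℝ) : stdPDF x = gaussianPDFReal 0 1 x := by
  simp [stdPDF, gaussianPDFReal]

lemma integrable_stdPDF : Integrable stdPDF := by
  have : stdPDF = gaussianPDFReal 0 1 := funext stdPDF_eq_gaussianPDFReal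
  rw [this]; exact integrable_gaussianPDFReal 0 1

lemma integrable_mul_stdPDF : Integrable (fun x => x * stdPDF x) := by
  have h := (integrable_mul_exp_neg_mul_sq (b := 1 / 2) (by norm_num)).const_mul
    (Real.sqrt (2 * Real.pi))⁻¹
  refine h.congr (Filter.Eventually.of_forall fun x => ?_)
  simp only [stdPDF]
  rw [show -(1 / 2 : ℝ) * x ^ 2 = -(x ^ 2) / 2 by ring]
  ring

lemma integral_Ioi_stdPDF (a : ℝ) : ∫ u in Set.Ioi (-a), stdPDF u = stdCDF a := by
  rw [stdCDF, ← integral_comp_neg_Iic]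
  simp [stdPDF]

lemma hasDerivAt_stdPDF (x : ℝ) : HasDerivAt (fun y => -stdPDF y) (x * stdPDF x) x := by
  have h1 : HasDerivAt (fun y : ℝ => -(y ^ 2) / 2) (-x) x := by
    have := ((hasDerivAt_pow 2 x).neg).div_const 2
    refine this.congr_deriv ?_
    simp
    ring
  have := (h1.exp.const_mul (Real.sqrt (2 * Real.pi))⁻¹).neg
  refine this.congr_deriv ?_
  simp only [stdPDF]; ring

lemma tendsto_stdPDF : Filter.Tendsto (fun y => -stdPDF y) Filter.atTop (nhds 0) := by
  have h1 : Filter.Tendsto (fun y : ℝ => -(y ^ 2) / 2) Filter.atTop Filter.atBot := by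
    have := (Filter.tendsto_pow_atTop (α := ℝ) (n := 2) (by norm_num)).const_mul_atTop_of_neg
      (r := -(1 / 2)) (by norm_num)
    refine this.congr fun x => ?_
    ring
  have := ((Real.tendsto_exp_atBot.comp h1).const_mul (Real.sqrt (2 * Real.pi))⁻¹).neg
  simpa [stdPDF, Function.comp_def] using this

lemma integral_Ioi_mul_stdPDF (a : ℝ) : ∫ u in Set.Ioi (-a), u * stdPDF u = stdPDF a := by
  rw [integral_Ioi_of_hasDerivAt_of_tendsto' (fun x _ => hasDerivAt_stdPDF x)
    integrable_mul_stdPDF.integrableOn tendsto_stdPDF]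
  simp [stdPDF]

lemma setIntegral_gaussian (m s : ℝ) (hs : 0 < s) (v : ℝ≥0) (hv : (v : ℝ) = s ^ 2)
    (h : ℝ → ℝ) (hh : Measurable h) :
    ∫ x in Set.Ioi 0, h x ∂(gaussianReal m v) =
      ∫ u in Set.Ioi (-(m / s)), h (s * u + m) * stdPDF u := by
  have hmap : (gaussianReal 0 1).map (fun u => s * u + m) = gaussianReal m v := by
    have e : (fun u : ℝ => s * u + m) = (fun x => x + m) ∘ (fun u => s * u) := rfl
    rw [e, ← Measure.map_map (by fun_prop) (by fun_prop), gaussianReal_map_const_mul,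
      gaussianReal_map_add_const]
    congr 1
    · simp
    · ext; simp [hv]
  rw [← hmap, setIntegral_map measurableSet_Ioi hh.aestronglyMeasurable (by fun_prop)]
  have hset : (fun u => s * u + m) ⁻¹' Set.Ioi 0 = Set.Ioi (-(m / s)) := by
    ext u
    simp only [Set.mem_preimage, Set.mem_Ioi]
    rw [← neg_div, div_lt_iff₀ hs]
    constructor <;> intro h <;> linarith
  rw [hset, ← integral_indicator measurableSet_Ioi, integral_gaussianReal_eq_integral_smul (by simp),
    ← integral_indicator measurableSet_Ioi]
  congr 1
  ext u
  by_cases hu : u ∈ Set.Ioi (-(m / s))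
  · simp only [Set.indicator_of_mem hu, stdPDF_eq_gaussianPDFReal, smul_eq_mul]; ring
  · simp [Set.indicator_of_notMem hu]

lemma setIntegral_gaussian_one (m s : ℝ) (hs : 0 < s) (v : ℝ≥0) (hv : (v : ℝ) = s ^ 2) :
    ∫ _ in Set.Ioi 0, (1 : ℝ) ∂(gaussianReal m v) = stdCDF (m / s) := by
  rw [setIntegral_gaussian m s hs v hv (fun _ => 1) (by fun_prop)]
  simp only [one_mul]
  exact integral_Ioi_stdPDF _

lemma setIntegral_gaussian_id (m s : ℝ) (hs : 0 < s) (v : ℝ≥0) (hv : (v : ℝ) = s ^ 2) :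
    ∫ x in Set.Ioi 0, x ∂(gaussianReal m v) = m * stdCDF (m / s) + s * stdPDF (m / s) := by
  rw [setIntegral_gaussian m s hs v hv (fun x => x) (by fun_prop)]
  have : ∀ u, (s * u + m) * stdPDF u = s * (u * stdPDF u) + m * stdPDF u := fun u => by ring
  simp only [this]
  rw [integral_add (integrable_mul_stdPDF.integrableOn.const_mul s)
    (integrable_stdPDF.integrableOn.const_mul m), integral_const_mul, integral_const_mul,
    integral_Ioi_mul_stdPDF, integral_Ioi_stdPDF]
  ring

lemma map_eval_pi (n : ℕ) (μ : ℝ) (v : ℝ≥0) (i : Fin n) :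
    (Measure.pi fun _ : Fin n => gaussianReal μ v).map (fun ω => ω i) = gaussianReal μ v :=
  (measurePreserving_eval (fun _ : Fin n => gaussianReal μ v) i).map_eq

lemma iIndep_pi (n : ℕ) (μ : ℝ) (v : ℝ≥0) :
    iIndepFun (fun (i : Fin n) (ω : Fin n → ℝ) => ω i)
      (Measure.pi fun _ : Fin n => gaussianReal μ v) :=
  iIndepFun_pi (X := fun _ x => x) (fun _ => aemeasurable_id)

lemma map_sum_pi (n : ℕ) (μ : ℝ) (v : ℝ≥0) (G : Finset (Fin n)) :
    (Measure.pi fun _ : Fin n => gaussianReal μ v).map (∑ j ∈ G, fun ω : Fin n → ℝ => ω j)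
      = gaussianReal (G.card * μ) (G.card * v) := by
  induction G using Finset.induction_on with
  | empty =>
    simp only [Finset.sum_empty, Finset.card_empty, Nat.cast_zero, zero_mul,
      gaussianReal_zero_var]
    change Measure.map (fun _ => (0 : ℝ)) _ = _
    rw [Measure.map_const]; simp
  | insert a s ha ih =>
    rw [Finset.sum_insert ha, gaussianReal_add_gaussianReal_of_indepFun _ (map_eval_pi n μ v a) ih]
    · rw [Finset.card_insert_of_notMem ha]
      congr 1 <;> push_cast <;> ring
    · exact ((iIndep_pi n μ v).indepFun_finsetSum_of_notMem (fun i => measurable_pi_apply i)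
        ha).symm

lemma integrable_eval_pi (n : ℕ) (μ : ℝ) (v : ℝ≥0) (i : Fin n) :
    Integrable (fun ω : Fin n → ℝ => ω i) (Measure.pi fun _ : Fin n => gaussianReal μ v) := by
  have h : Integrable (id : ℝ → ℝ) (gaussianReal μ v) :=
    memLp_one_iff_integrable.1 (by simpa using memLp_id_gaussianReal (μ := μ) (v := v) 1)
  exact (measurePreserving_eval (fun _ : Fin n => gaussianReal μ v) i).integrable_comp_of_integrable h

lemma swap_pi (n : ℕ) (μ : ℝ) (v : ℝ≥0) (G : Finset (Fin n)) (i k : Fin n)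
    (hi : i ∈ G) (hk : k ∈ G) :
    ∫ ω in {ω : Fin n → ℝ | 0 < ∑ j ∈ G, ω j}, ω i
        ∂(Measure.pi fun _ : Fin n => gaussianReal μ v)
      = ∫ ω in {ω : Fin n → ℝ | 0 < ∑ j ∈ G, ω j}, ω k
        ∂(Measure.pi fun _ : Fin n => gaussianReal μ v) := by
  have hmp := measurePreserving_piCongrLeft (fun _ : Fin n => gaussianReal μ v) (Equiv.swap i k)
  have hf : ∀ (ω : Fin n → ℝ) (j : Fin n),
      MeasurableEquiv.piCongrLeft (fun _ : Fin n => ℝ) (Equiv.swap i k) ω j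
        = ω (Equiv.swap i k j) := by
    intro ω j
    have := Equiv.piCongrLeft_apply_apply (fun _ : Fin n => ℝ) (Equiv.swap i k) ω
      (Equiv.swap i k j)
    rw [Equiv.swap_apply_self] at this
    exact this
  rw [← hmp.setIntegral_preimage_emb (MeasurableEquiv.measurableEmbedding _)]
  simp only [hf, Equiv.swap_apply_left]
  congr 2
  ext ω
  simp only [Set.mem_preimage, Set.mem_ofPred_eq, hf]
  rw [Finset.sum_equiv (Equiv.swap i k) (s := G) (t := G) (g := fun j => ω j)]
  · intro j
    by_cases h1 : j = i
    · subst h1; simp [hi, hk]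
    · by_cases h2 : j = k
      · subst h2; simp [hi, hk]
      · rw [Equiv.swap_apply_of_ne_of_ne h1 h2]
  · intros; rfl

lemma accepted_iff (n : ℕ) (G : Finset (Fin n)) (g ℓ : ℕ)
    (hgcard : G.card = g) (hℓ : ℓ = n - g) (t : ℤ)
    (htl : (ℓ : ℤ) ≤ t) (htg : t < (g : ℤ)) (ω : Fin n → ℝ) :
    t < ((Finset.univ.filter fun i : Fin n =>
        if i ∈ G then 0 < ∑ j ∈ G, ω j else 0 < ω i).card : ℤ) ↔ 0 < ∑ j ∈ G, ω j := by
  constructor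
  · intro h
    by_contra hn
    have hsub : (Finset.univ.filter fun i : Fin n =>
        if i ∈ G then 0 < ∑ j ∈ G, ω j else 0 < ω i) ⊆ Gᶜ := by
      intro i hi
      rw [Finset.mem_filter] at hi
      rw [Finset.mem_compl]
      intro hG
      exact hn (by simpa [hG] using hi.2)
    have := Finset.card_le_card hsub
    rw [Finset.card_compl, Fintype.card_fin] at this
    omega
  · intro h
    have hsub : G ⊆ (Finset.univ.filter fun i : Fin n =>
        if i ∈ G then 0 < ∑ j ∈ G, ω j else 0 < ω i) := by
      intro i hi
      rw [Finset.mem_filter]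
      simp [hi, h]
    have := Finset.card_le_card hsub
    omega

/-- In the one-step ViSE model with a Gaussian proposal generator, if the
group alone can both pass and block any proposal, i.e., `ℓ ≤ t < g`, then all decisions are
made by the group: the ECG of an individualist equals `μ Φ(√g μ/σ)` and the ECG of a group
member equals `μ Φ(√g μ/σ) + (σ/√g) φ(√g μ/σ)`. In particular, in a neutral environment
(`μ = 0`) the individualist's ECG is `0` and the group member's ECG is `σ/√(2πg)`. -/
theorem group_dictatorship_ECG
    (n : ℕ) (G : Finset (Fin n)) (g ℓ : ℕ)
    (hgcard : G.card = g) (hg1 : 1 ≤ g) (hℓ : ℓ = n - g)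
    (μ σ : ℝ) (hσ : 0 < σ) (t : ℤ)
    -- the group alone can both pass and block any proposal
    (htl : (ℓ : ℤ) ≤ t) (htg : t < (g : ℤ))
    -- the proposal is a vector of i.i.d. N(μ, σ²) components
    (ν : Measure (Fin n → ℝ))
    (hν : ν = Measure.pi fun _ : Fin n => gaussianReal μ (⟨σ ^ 2, sq_nonneg σ⟩ : ℝ≥0))
    -- the set of proposals that are accepted: strictly more than `t` votes in favor,
    -- where individualist `i` votes iff `ω i > 0` and group members vote iff `∑_{j∈G} ω j > 0`
    (A : Set (Fin n → ℝ))
    (hA : A = {ω : Fin n → ℝ |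
      t < ((Finset.univ.filter fun i : Fin n =>
        if i ∈ G then 0 < ∑ j ∈ G, ω j else 0 < ω i).card : ℤ)}) :
    (∀ i : Fin n, i ∉ G →
      ∫ ω in A, ω i ∂ν = μ * stdCDF (Real.sqrt g * μ / σ))
    ∧ (∀ i : Fin n, i ∈ G →
      ∫ ω in A, ω i ∂ν =
        μ * stdCDF (Real.sqrt g * μ / σ) + σ / Real.sqrt g * stdPDF (Real.sqrt g * μ / σ))
    ∧ (μ = 0 →
        (∀ i : Fin n, i ∉ G → ∫ ω in A, ω i ∂ν = 0)
        ∧ ∀ i : Fin n, i ∈ G → ∫ ω in A, ω i ∂ν = σ / Real.sqrt (2 * Real.pi * g)) := by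
  have hAS : A = {ω : Fin n → ℝ | 0 < ∑ j ∈ G, ω j} := by
    rw [hA]; ext ω
    exact accepted_iff n G g ℓ hgcard hℓ t htl htg ω
  clear hA
  subst hAS
  obtain ⟨v, hv, hν⟩ : ∃ v : ℝ≥0, (v : ℝ) = σ ^ 2 ∧
      ν = Measure.pi fun _ : Fin n => gaussianReal μ v := ⟨⟨σ ^ 2, sq_nonneg σ⟩, rfl, hν⟩
  have hg0 : (0 : ℝ) < g := by exact_mod_cast hg1
  have hsg : 0 < Real.sqrt g := Real.sqrt_pos.2 hg0
  have hsq : Real.sqrt g * Real.sqrt g = g := Real.mul_self_sqrt hg0.le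
  have hlaw := map_sum_pi n μ v G
  rw [← hν, hgcard] at hlaw
  have hfun : (∑ j ∈ G, fun ω : Fin n → ℝ => ω j) = fun ω => ∑ j ∈ G, ω j := by
    ext ω; simp
  rw [hfun] at hlaw
  have hSm : Measurable (fun ω : Fin n → ℝ => ∑ j ∈ G, ω j) := by fun_prop
  have hAm : MeasurableSet {ω : Fin n → ℝ | 0 < ∑ j ∈ G, ω j} := hSm measurableSet_Ioi
  have hvar : (((g : ℝ≥0) * v : ℝ≥0) : ℝ) = (Real.sqrt g * σ) ^ 2 := by
    push_cast; rw [hv, mul_pow, sq (Real.sqrt g), hsq]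
  have hratio : g * μ / (Real.sqrt g * σ) = Real.sqrt g * μ / σ := by
    rw [div_eq_div_iff (by positivity) (by positivity)]
    nth_rewrite 1 [← hsq]; ring
  have h1 := setIntegral_gaussian_one (g * μ) (Real.sqrt g * σ) (by positivity) _ hvar
  have h2 := setIntegral_gaussian_id (g * μ) (Real.sqrt g * σ) (by positivity) _ hvar
  rw [hratio] at h1 h2
  rw [← hlaw, setIntegral_map measurableSet_Ioi (by fun_prop) hSm.aemeasurable] at h1 h2
  have hpre : (fun ω : Fin n → ℝ => ∑ j ∈ G, ω j) ⁻¹' Set.Ioi 0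
    = {ω : Fin n → ℝ | 0 < ∑ j ∈ G, ω j} := rfl
  rw [hpre] at h1 h2
  have hind : ∀ i : Fin n, i ∉ G →
      ∫ ω in {ω : Fin n → ℝ | 0 < ∑ j ∈ G, ω j}, ω i ∂ν
        = μ * stdCDF (Real.sqrt g * μ / σ) := by
    intro i hi
    have hI : IndepFun (fun ω : Fin n → ℝ => ∑ j ∈ G, ω j) (fun ω => ω i) ν := by
      rw [hν, ← hfun]
      exact (iIndep_pi n μ v).indepFun_finsetSum_of_notMem (fun i => measurable_pi_apply i) hi
    have hmean : ∫ ω, ω i ∂ν = μ := by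
      have := integral_id_gaussianReal (μ := μ) (v := v)
      rw [← map_eval_pi n μ v i, ← hν, integral_map (measurable_pi_apply i).aemeasurable (by fun_prop)] at this
      exact this
    have hm := hI.symm.integral_fun_comp_mul_comp (f := fun x : ℝ => x)
      (g := (Set.Ioi (0 : ℝ)).indicator (fun _ => (1 : ℝ))) (measurable_pi_apply i).aemeasurable
      hSm.aemeasurable
      (by fun_prop) ((measurable_const.indicator measurableSet_Ioi).aestronglyMeasurable)
    rw [hmean] at hm
    rw [← h1, ← integral_indicator hAm, ← integral_indicator hAm]
    refine Eq.trans (integral_congr_ae (Filter.Eventually.of_forall fun ω => ?_)) (hm.trans ?_)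
    · by_cases h : 0 < ∑ j ∈ G, ω j <;> simp [Set.indicator, h]
    · rfl
  have hgrp : ∀ i : Fin n, i ∈ G →
      ∫ ω in {ω : Fin n → ℝ | 0 < ∑ j ∈ G, ω j}, ω i ∂ν
        = μ * stdCDF (Real.sqrt g * μ / σ) + σ / Real.sqrt g * stdPDF (Real.sqrt g * μ / σ) := by
    intro i hi
    rw [integral_finsetSum G (fun j _ => by
      rw [hν]; exact (integrable_eval_pi n μ v j).integrableOn)] at h2
    rw [Finset.sum_congr rfl (g := fun _ =>
      ∫ ω in {ω : Fin n → ℝ | 0 < ∑ j ∈ G, ω j}, ω i ∂ν)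
      (fun k hk => by rw [hν]; exact swap_pi n μ v G k i hk hi), Finset.sum_const, hgcard,
      nsmul_eq_mul] at h2
    apply mul_left_cancel₀ hg0.ne'
    rw [h2, mul_add, ← mul_assoc, ← mul_assoc]
    congr 2
    rw [mul_div_assoc', eq_div_iff hsg.ne']
    linear_combination σ * hsq
  refine ⟨hind, hgrp, fun hμ => ⟨fun i hi => ?_, fun i hi => ?_⟩⟩
  · rw [hind i hi, hμ, zero_mul]
  · rw [hgrp i hi, hμ, Real.sqrt_mul (by positivity)]
    simp only [stdPDF, zero_mul, mul_zero, zero_div, zero_add]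
    simp
    field_simp
end
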